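/- Let a, b, c, d be real with t = a+b+c+d, let n ≥ k ≥ 0 be integers, and let (x,y) be real with x ≠ 1; write u(x,y) = P_{n,k}^{(a,b,c,d)}(x,y). Then (k/(1−x))·u + ∂u/∂x − (y/(1−x))·∂u/∂y = (n+k+t+2)·P_{n−1,k}^{(a+1,b,c,d+1)}(x,y), and (x(k+a+b+c+d+1) − a)·u − x(1−x)·∂u/∂x + xy·∂u/∂y = (n−k+1)·P_{n+1,k}^{(a−1,b,c,d−1)}(x,y). -/

import Mathlib

noncomputable section

/-- Generalized binomial coefficient `C(α, j) = α(α−1)⋯(α−j+1)/j!`. -/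
def genBinom (α : ℝ) (j : ℕ) : ℝ :=
  (∏ i ∈ Finset.range j, (α - i)) / (Nat.factorial j)

/-- Jacobi polynomial `P_n^{(a,b)}(x)`; zero for negative `n`. -/
def jacobiP (n : ℤ) (a b : ℝ) (x : ℝ) : ℝ :=
  if n < 0 then 0 else
    ∑ m ∈ Finset.range (n.toNat + 1),
      genBinom ((n : ℝ) + a) (n.toNat - m) * genBinom ((n : ℝ) + b) m *
        ((x - 1) / 2) ^ m * ((x + 1) / 2) ^ (n.toNat - m)

/-- Four-parameter Koornwinder polynomial `P_{n,k}^{(a,b,c,d)}(x,y)`;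
zero whenever `k < 0`, `n < 0`, or `k > n` (covering the conventions
`k = −1`, `n = −1`, `k = n+1`). -/
def koornP (n k : ℤ) (a b c d : ℝ) (x y : ℝ) : ℝ :=
  if n < 0 ∨ k < 0 ∨ n < k then 0 else
    jacobiP (n - k) (2 * (k : ℝ) + b + c + d + 1) a (2 * x - 1) *
      (1 - x) ^ k.toNat * jacobiP k c b (-1 + 2 * y / (1 - x))

theorem genBinom_succ_mul (α : ℝ) (j : ℕ) :
    ((j : ℝ) + 1) * genBinom α (j + 1) = (α - j) * genBinom α j := by
  have h : ((j.factorial : ℕ) : ℝ) ≠ 0 := by exact_mod_cast j.factorial_ne_zero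
  have h' : (j : ℝ) + 1 ≠ 0 := by positivity
  unfold genBinom
  rw [Finset.prod_range_succ, Nat.factorial_succ]
  push_cast
  field_simp

theorem jacobiP_natCast (N : ℕ) (α β s : ℝ) :
    jacobiP (N : ℤ) α β s = ∑ m ∈ Finset.range (N + 1),
      genBinom ((N : ℝ) + α) (N - m) * genBinom ((N : ℝ) + β) m *
        ((s - 1) / 2) ^ m * ((s + 1) / 2) ^ (N - m) := by
  simp [jacobiP]

theorem jacobiP_natCast_two_mul_sub_one (N : ℕ) (α β x : ℝ) :
    jacobiP (N : ℤ) α β (2 * x - 1) = ∑ m ∈ Finset.range (N + 1),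
      genBinom ((N : ℝ) + α) (N - m) * genBinom ((N : ℝ) + β) m *
        (x - 1) ^ m * x ^ (N - m) := by
  rw [jacobiP_natCast, show (2 * x - 1 - 1) / 2 = x - 1 by ring,
    show (2 * x - 1 + 1) / 2 = x by ring]

theorem differentiable_jacobiP (N : ℕ) (α β : ℝ) :
    Differentiable ℝ (jacobiP (N : ℤ) α β) := by
  rw [funext (jacobiP_natCast N α β)]
  fun_prop

theorem hasDerivAt_jacobiP_sum (N : ℕ) (α β x : ℝ) :
    HasDerivAt (fun x => jacobiP (N : ℤ) α β (2 * x - 1))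
      (∑ m ∈ Finset.range (N + 1),
        genBinom ((N : ℝ) + α) (N - m) * genBinom ((N : ℝ) + β) m *
          ((m : ℝ) * (x - 1) ^ (m - 1) * x ^ (N - m)
            + (x - 1) ^ m * (((N - m : ℕ) : ℝ) * x ^ (N - m - 1)))) x := by
  rw [funext (jacobiP_natCast_two_mul_sub_one N α β)]
  refine HasDerivAt.fun_sum fun m _ => ?_
  have h1 : HasDerivAt (fun x : ℝ => (x - 1) ^ m) ((m : ℝ) * (x - 1) ^ (m - 1)) x := by
    simpa using ((hasDerivAt_id' x).sub_const 1).fun_pow m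
  have h := (h1.mul (hasDerivAt_pow (N - m) x)).const_mul
    (genBinom ((N : ℝ) + α) (N - m) * genBinom ((N : ℝ) + β) m)
  refine h.congr_of_eventuallyEq (Filter.Eventually.of_forall fun z => ?_)
  simp only [Pi.mul_apply]
  ring

/-- Differentiation lowers the degree of a Jacobi polynomial and raises both parameters. -/
theorem hasDerivAt_jacobiP (N : ℕ) (α β x : ℝ) :
    HasDerivAt (fun x => jacobiP (N : ℤ) α β (2 * x - 1))
      (((N : ℝ) + α + β + 1) * jacobiP ((N : ℤ) - 1) (α + 1) (β + 1) (2 * x - 1)) x := by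
  convert hasDerivAt_jacobiP_sum N α β x using 1
  rcases N with _ | M
  · simp [jacobiP]
  rw [show (((M + 1 : ℕ) : ℤ) - 1) = (M : ℤ) by push_cast; ring,
    jacobiP_natCast_two_mul_sub_one]
  simp only [mul_add, Finset.sum_add_distrib]
  rw [Finset.sum_range_succ' _ (M + 1), Finset.sum_range_succ _ (M + 1)]
  simp only [Nat.cast_zero, Nat.sub_self, zero_mul, mul_zero, add_zero, Finset.mul_sum]
  rw [← Finset.sum_add_distrib]
  refine Finset.sum_congr rfl fun m hm => ?_
  obtain ⟨r, rfl⟩ := Nat.exists_eq_add_of_le (Nat.lt_succ_iff.mp (Finset.mem_range.mp hm))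
  rw [show m + r + 1 - (m + 1) = r by omega, show m + r + 1 - m = r + 1 by omega,
    show m + r - m = r by omega]
  simp only [Nat.add_sub_cancel]
  push_cast
  rw [show (m : ℝ) + r + (α + 1) = m + r + 1 + α by ring,
    show (m : ℝ) + r + (β + 1) = m + r + 1 + β by ring]
  have e1 := genBinom_succ_mul ((m : ℝ) + r + 1 + α) r
  have e2 := genBinom_succ_mul ((m : ℝ) + r + 1 + β) m
  linear_combination
    (-(genBinom ((m : ℝ) + r + 1 + β) m * (x - 1) ^ m * x ^ r)) * e1
      - (genBinom ((m : ℝ) + r + 1 + α) r * (x - 1) ^ m * x ^ r) * e2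

/-- The first-order operator raising the degree of a Jacobi polynomial and lowering
both parameters. -/
theorem jacobiP_raise (N : ℕ) (α β x : ℝ) :
    (x * (α + β) - β) * jacobiP (N : ℤ) α β (2 * x - 1)
        - x * (1 - x) * deriv (fun x => jacobiP (N : ℤ) α β (2 * x - 1)) x
      = ((N : ℝ) + 1) * jacobiP ((N : ℤ) + 1) (α - 1) (β - 1) (2 * x - 1) := by
  rw [(hasDerivAt_jacobiP_sum N α β x).deriv, show ((N : ℤ) + 1) = ((N + 1 : ℕ) : ℤ) by simp,
    jacobiP_natCast_two_mul_sub_one, jacobiP_natCast_two_mul_sub_one]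
  have hα : ((N + 1 : ℕ) : ℝ) + (α - 1) = N + α := by push_cast; ring
  have hβ : ((N + 1 : ℕ) : ℝ) + (β - 1) = N + β := by push_cast; ring
  rw [hα, hβ]
  have split : ((N : ℝ) + 1) * ∑ m ∈ Finset.range (N + 1 + 1),
        genBinom ((N : ℝ) + α) (N + 1 - m) * genBinom ((N : ℝ) + β) m *
          (x - 1) ^ m * x ^ (N + 1 - m)
      = (∑ m ∈ Finset.range (N + 1 + 1), ((N : ℝ) + 1 - m) *
          (genBinom ((N : ℝ) + α) (N + 1 - m) * genBinom ((N : ℝ) + β) m *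
            (x - 1) ^ m * x ^ (N + 1 - m)))
        + ∑ m ∈ Finset.range (N + 1 + 1), (m : ℝ) *
          (genBinom ((N : ℝ) + α) (N + 1 - m) * genBinom ((N : ℝ) + β) m *
            (x - 1) ^ m * x ^ (N + 1 - m)) := by
    rw [← Finset.sum_add_distrib, Finset.mul_sum]
    exact Finset.sum_congr rfl fun m _ => by ring
  rw [split, Finset.sum_range_succ _ (N + 1), Finset.sum_range_succ' _ (N + 1)]
  simp only [Nat.cast_add, Nat.cast_one, Nat.cast_zero, sub_self, zero_mul, add_zero]
  rw [← Finset.sum_add_distrib, Finset.mul_sum, Finset.mul_sum, ← Finset.sum_sub_distrib]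
  refine Finset.sum_congr rfl fun m hm => ?_
  obtain ⟨r, rfl⟩ := Nat.exists_eq_add_of_le (Nat.lt_succ_iff.mp (Finset.mem_range.mp hm))
  rw [show m + r + 1 - (m + 1) = r by omega, show m + r + 1 - m = r + 1 by omega,
    show m + r - m = r by omega]
  push_cast
  have e1 := genBinom_succ_mul ((m : ℝ) + r + α) r
  have e2 := genBinom_succ_mul ((m : ℝ) + r + β) m
  have p1 : (m : ℝ) * (x - 1) ^ (m - 1) * (x - 1) = m * (x - 1) ^ m := by
    rcases m with _ | m
    · simp
    · rw [Nat.add_sub_cancel]; ring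
  have p2 : (r : ℝ) * x ^ (r - 1) * x = r * x ^ r := by
    rcases r with _ | r
    · simp
    · rw [Nat.add_sub_cancel]; ring
  linear_combination
    (-(genBinom ((m : ℝ) + r + β) m * (x - 1) ^ m * x ^ (r + 1))) * e1
      - (genBinom ((m : ℝ) + r + α) r * (x - 1) ^ (m + 1) * x ^ r) * e2
      + (genBinom ((m : ℝ) + r + α) r * genBinom ((m : ℝ) + r + β) m * x ^ (r + 1)) * p1
      + (genBinom ((m : ℝ) + r + α) r * genBinom ((m : ℝ) + r + β) m * (x - 1) ^ (m + 1)) * p2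

theorem koornP_natCast (N K : ℕ) (a b c d x y : ℝ) :
    koornP ((K : ℤ) + N) K a b c d x y =
      jacobiP N (2 * (K : ℝ) + b + c + d + 1) a (2 * x - 1) *
        (1 - x) ^ K * jacobiP K c b (-1 + 2 * y / (1 - x)) := by
  rw [koornP, if_neg (by omega), add_sub_cancel_left]
  simp

theorem koornP_natCast_pred (N K : ℕ) (a b c d x y : ℝ) :
    koornP ((K : ℤ) + N - 1) K a b c d x y =
      jacobiP ((N : ℤ) - 1) (2 * (K : ℝ) + b + c + d + 1) a (2 * x - 1) *
        (1 - x) ^ K * jacobiP K c b (-1 + 2 * y / (1 - x)) := by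
  rcases N with _ | N
  · rw [koornP, if_pos (by omega)]
    simp [jacobiP]
  · rw [show (K : ℤ) + (N + 1 : ℕ) - 1 = K + N by push_cast; ring, koornP_natCast,
      show ((N + 1 : ℕ) : ℤ) - 1 = N by push_cast; ring]

theorem hasDerivAt_koornP_fst (N K : ℕ) (a b c d x y : ℝ) (hx : x ≠ 1) :
    HasDerivAt (fun x' => koornP ((K : ℤ) + N) K a b c d x' y)
      (deriv (fun x => jacobiP N (2 * (K : ℝ) + b + c + d + 1) a (2 * x - 1)) x *
          (1 - x) ^ K * jacobiP K c b (-1 + 2 * y / (1 - x))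
        - K / (1 - x) * koornP ((K : ℤ) + N) K a b c d x y
        + jacobiP N (2 * (K : ℝ) + b + c + d + 1) a (2 * x - 1) * (1 - x) ^ K *
          (deriv (jacobiP K c b) (-1 + 2 * y / (1 - x)) * (2 * y / (1 - x) ^ 2))) x := by
  have h1 : 1 - x ≠ 0 := sub_ne_zero.mpr hx.symm
  have hlin : HasDerivAt (fun x : ℝ => 1 - x) (-1) x := by
    simpa using (hasDerivAt_id x).const_sub 1
  have hp := (hasDerivAt_jacobiP N (2 * (K : ℝ) + b + c + d + 1) a
    x).differentiableAt.hasDerivAt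
  have hz : HasDerivAt (fun x : ℝ => -1 + 2 * y / (1 - x)) (2 * y / (1 - x) ^ 2) x := by
    refine (((hasDerivAt_const x (2 * y)).fun_div hlin h1).const_add (-1)).congr_deriv ?_
    ring
  have hq := ((differentiable_jacobiP K c b) (-1 + 2 * y / (1 - x))).hasDerivAt.comp x hz
  have h := (hp.mul (hlin.pow K)).mul hq
  have hpow : (K : ℝ) * (1 - x) ^ (K - 1) = K / (1 - x) * (1 - x) ^ K := by
    rcases K with _ | K
    · simp
    · rw [Nat.add_sub_cancel]; field_simp; ring
  rw [funext fun x' => koornP_natCast N K a b c d x' y, koornP_natCast]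
  refine h.congr_deriv ?_
  simp only [Pi.mul_apply, Pi.pow_apply, Function.comp_apply]
  linear_combination -jacobiP N (2 * (K : ℝ) + b + c + d + 1) a (2 * x - 1) *
    jacobiP K c b (-1 + 2 * y / (1 - x)) * hpow

theorem hasDerivAt_koornP_snd (N K : ℕ) (a b c d x y : ℝ) :
    HasDerivAt (koornP ((K : ℤ) + N) K a b c d x)
      (jacobiP N (2 * (K : ℝ) + b + c + d + 1) a (2 * x - 1) * (1 - x) ^ K *
        (deriv (jacobiP K c b) (-1 + 2 * y / (1 - x)) * (2 / (1 - x)))) y := by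
  have hz : HasDerivAt (fun y : ℝ => -1 + 2 * y / (1 - x)) (2 / (1 - x)) y := by
    simpa using (((hasDerivAt_id y).const_mul 2).div_const (1 - x)).const_add (-1)
  rw [funext fun y' => koornP_natCast N K a b c d x y']
  exact (((differentiable_jacobiP K c b) (-1 + 2 * y / (1 - x))).hasDerivAt.comp y
    hz).const_mul _

theorem koorn_ladder_M10 (a b c d : ℝ) (n k : ℤ) (hk : 0 ≤ k) (hnk : k ≤ n)
    (x y : ℝ) (hx : x ≠ 1) :
    ((k : ℝ) / (1 - x)) * koornP n k a b c d x y
        + deriv (fun x' => koornP n k a b c d x' y) x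
        - (y / (1 - x)) * deriv (koornP n k a b c d x) y
      = ((n : ℝ) + (k : ℝ) + (a + b + c + d) + 2)
          * koornP (n - 1) k (a + 1) b c (d + 1) x y ∧
    (x * ((k : ℝ) + a + b + c + d + 1) - a) * koornP n k a b c d x y
        - x * (1 - x) * deriv (fun x' => koornP n k a b c d x' y) x
        + x * y * deriv (koornP n k a b c d x) y
      = ((n : ℝ) - (k : ℝ) + 1) * koornP (n + 1) k (a - 1) b c (d - 1) x y := by
  obtain ⟨K, rfl⟩ := Int.eq_ofNat_of_zero_le hk
  obtain ⟨N, rfl⟩ := Int.le.dest hnk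
  have h1 : 1 - x ≠ 0 := sub_ne_zero.mpr hx.symm
  have hp := (hasDerivAt_jacobiP N (2 * (K : ℝ) + b + c + d + 1) a x).deriv
  have hr := jacobiP_raise N (2 * (K : ℝ) + b + c + d + 1) a x
  rw [(hasDerivAt_koornP_fst N K a b c d x y hx).deriv,
    (hasDerivAt_koornP_snd N K a b c d x y).deriv, koornP_natCast_pred,
    show (K : ℤ) + N + 1 = K + (N + 1 : ℕ) by push_cast; ring, koornP_natCast, koornP_natCast,
    show 2 * (K : ℝ) + b + c + (d + 1) + 1 = 2 * K + b + c + d + 1 + 1 by ring,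
    show 2 * (K : ℝ) + b + c + (d - 1) + 1 = 2 * K + b + c + d + 1 - 1 by ring]
  push_cast
  constructor
  · rw [hp]
    field_simp
    ring
  · generalize deriv (fun x => jacobiP N (2 * (K : ℝ) + b + c + d + 1) a (2 * x - 1)) x = D at hr ⊢
    have hr' := congrArg
      (fun z => z * ((1 - x) ^ K * jacobiP K c b (-1 + 2 * y / (1 - x)))) hr
    rw [show ((K : ℝ) + N - K + 1) = N + 1 by ring]
    refine Eq.trans ?_ (hr'.trans (by ring))
    field_simp
    ring
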